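/- arXiv:0907.0876 — 3 statements merged into one kernel-verified Lean document; each statement's English description precedes it below -/
import Mathlib

section
/- Let R be a commutative ring with many units. Then S(R) := H_0(GL_2(R), ker(∂_1 : D_1(R²) → D_0(R²))) is isomorphic to ℤ ⊕ K_2^M(R); under the identification of S(R) as the group generated by classes [a_1, a_2] (a_1, a_2 ∈ R^×), the splitting ℤ → S(R) is given by 1 ↦ [1,1] and the projection S(R) → K_2^M(R) is given by [a, b] ↦ {a, b}. -/
/-- `R^× ⊗_ℤ R^×`: the tensor square of the (additively written) abelian group of
units of `R`. -/
abbrev TT (R : Type) [CommRing R] : Type :=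
  TensorProduct ℤ (Additive Rˣ) (Additive Rˣ)

/-- The elementary tensor `a ⊗ b` for units `a b : Rˣ`. -/
noncomputable def tmulU (R : Type) [CommRing R] (a b : Rˣ) : TT R :=
  TensorProduct.tmul ℤ (Additive.ofMul a) (Additive.ofMul b)

/-- The subgroup of `R^× ⊗ R^×` generated by the elements `a ⊗ b + b ⊗ a`. -/
noncomputable def sigmaSub (R : Type) [CommRing R] : AddSubgroup (TT R) :=
  AddSubgroup.closure {x | ∃ a b : Rˣ, x = tmulU R a b + tmulU R b a}

/-- `(R^× ⊗ R^×)_σ`. -/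
abbrev Tsigma (R : Type) [CommRing R] : Type := TT R ⧸ sigmaSub R

/-- Canonical projection onto `(R^× ⊗ R^×)_σ`. -/
noncomputable def clsS (R : Type) [CommRing R] : TT R →+ Tsigma R :=
  QuotientAddGroup.mk' _

/-- The subgroup of `R^× ⊗ R^×` generated by the elements `a ⊗ (-a)`. -/
noncomputable def sbarSub (R : Type) [CommRing R] : AddSubgroup (TT R) :=
  AddSubgroup.closure {x | ∃ a : Rˣ, x = tmulU R a (-a)}

/-- `(R^× ⊗ R^×)_σ̄`. -/
abbrev Tsigmabar (R : Type) [CommRing R] : Type := TT R ⧸ sbarSub R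

/-- Canonical projection onto `(R^× ⊗ R^×)_σ̄`. -/
noncomputable def clsSb (R : Type) [CommRing R] : TT R →+ Tsigmabar R :=
  QuotientAddGroup.mk' _

/-- The subgroup of `R^× ⊗ R^×` generated by the elements `a ⊗ (1-a)`
with `a`, `1-a` units. -/
noncomputable def k2Sub (R : Type) [CommRing R] : AddSubgroup (TT R) :=
  AddSubgroup.closure {x | ∃ a b : Rˣ, (b : R) = 1 - (a : R) ∧ x = tmulU R a b}

/-- The Milnor K-group `K_2^M(R)`. -/
abbrev K2M (R : Type) [CommRing R] : Type := TT R ⧸ k2Sub R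

/-- Canonical projection onto `K_2^M(R)`; `clsK R (tmulU R a b)` is the symbol `{a, b}`. -/
noncomputable def clsK (R : Type) [CommRing R] : TT R →+ K2M R :=
  QuotientAddGroup.mk' _
/-- A commutative ring has *many units* if for every `n ≥ 2` and every finite family of
surjective linear forms `f i : R^n → R` there is a vector `v` with all `f i v` units. -/
def ManyUnits (R : Type) [CommRing R] : Prop :=
  ∀ n : ℕ, 2 ≤ n → ∀ (k : ℕ) (f : Fin k → ((Fin n → R) →ₗ[R] R)),
    (∀ i, Function.Surjective (f i)) → ∃ v : Fin n → R, ∀ i, IsUnit (f i v)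
/-- `R²` as column vectors. -/
abbrev V2 (R : Type) [CommRing R] : Type := Fin 2 → R

/-- `(l+1)`-tuples of vectors of `R²`. -/
abbrev Tup (R : Type) [CommRing R] (l : ℕ) : Type := Fin (l + 1) → V2 R

/-- A family of vectors of `R²` is a basis of a direct summand of `R²` if it is linearly
independent and its span admits a complement. -/
def IsBDS (R : Type) [CommRing R] {k : ℕ} (v : Fin k → V2 R) : Prop :=
  LinearIndependent R v ∧
  ∃ N : Submodule R (V2 R), IsCompl (Submodule.span R (Set.range v)) N

/-- An `(l+1)`-tuple is a frame (a basis element of `D_l(R²)`) if every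
`min (l+1) 2` of its members form a basis of a direct summand of `R²`. -/
def IsFrame (R : Type) [CommRing R] {l : ℕ} (v : Tup R l) : Prop :=
  ∀ ι : Fin (min (l + 1) 2) → Fin (l + 1), Function.Injective ι → IsBDS R (v ∘ ι)

/-- The free `ℤ`-module on all `(l+1)`-tuples of vectors of `R²`. -/
abbrev EE (R : Type) [CommRing R] (l : ℕ) : Type := Tup R l →₀ ℤ

/-- `D_l(R²)`, the free `ℤ`-module on frames, as a subgroup of `EE R l`. -/
noncomputable def DD (R : Type) [CommRing R] (l : ℕ) : AddSubgroup (EE R l) :=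
  (Finsupp.supported ℤ ℤ {v : Tup R l | IsFrame R v}).toAddSubgroup

/-- The simplicial boundary `∂ : E_{l+1} → E_l`, the alternating sum of the face maps
deleting one entry of a tuple.  Its restriction to `D_{l+1}(R²)` is the differential
`∂_{l+1} : D_{l+1}(R²) → D_l(R²)`. -/
noncomputable def bdE (R : Type) [CommRing R] (l : ℕ) : EE R (l + 1) →+ EE R l :=
  Finsupp.liftAddHom fun v =>
    ∑ i : Fin (l + 2), ((-1 : ℤ) ^ (i : ℕ)) • Finsupp.singleAddHom (v ∘ i.succAbove)

/-- The diagonal action of `GL₂(R)` on tuples of vectors. -/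
def gT (R : Type) [CommRing R] {l : ℕ} (g : GL (Fin 2) R) (v : Tup R l) : Tup R l :=
  fun i => (g : Matrix (Fin 2) (Fin 2) R).mulVec (v i)

/-- The subgroup of `EE R l` generated by the elements `g • y - y` with `y ∈ S`;
for a `GL₂(R)`-stable subgroup `S` the quotient `S/(this ∩ S)` is the group of
coinvariants `H₀(GL₂(R), S)`. -/
noncomputable def coinvOf (R : Type) [CommRing R] (l : ℕ) (S : AddSubgroup (EE R l)) :
    AddSubgroup (EE R l) :=
  AddSubgroup.closure
    {x | ∃ (g : GL (Fin 2) R) (y : EE R l), y ∈ S ∧ x = Finsupp.mapDomain (gT R g) y - y}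

/-- `H₀(GL₂(R), S)`, the coinvariants of a (`GL₂(R)`-stable) subgroup `S ≤ EE R l`. -/
abbrev H0 (R : Type) [CommRing R] (l : ℕ) (S : AddSubgroup (EE R l)) : Type :=
  S ⧸ ((coinvOf R l S).addSubgroupOf S)

section Symbols

variable {R : Type} [CommRing R]

theorem ManyUnits.exists_unit (hR : ManyUnits R) (l : List (R × R))
    (hl : ∀ p ∈ l, IsUnit p.1 ∨ IsUnit p.2) :
    ∃ x : Rˣ, ∀ p ∈ l, IsUnit (p.1 * x + p.2) := by
  let m : List (R × R) := (1, 0) :: (0, 1) :: l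
  have hm : ∀ p ∈ m, IsUnit p.1 ∨ IsUnit p.2 := by
    intro p hp
    simp only [m, List.mem_cons] at hp
    rcases hp with rfl | rfl | hp
    · simp
    · simp
    · exact hl p hp
  let f : Fin m.length → ((Fin 2 → R) →ₗ[R] R) := fun i =>
    m[i].1 • LinearMap.proj 0 + m[i].2 • LinearMap.proj 1
  obtain ⟨v, hv⟩ := hR 2 le_rfl m.length f fun i => by
    intro y
    rcases hm m[i] (List.getElem_mem i.2) with ⟨u, hu⟩ | ⟨u, hu⟩
    · exact ⟨![↑u⁻¹ * y, 0], by simp [f, ← mul_assoc, show m[i.1].1 = u from hu.symm]⟩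
    · exact ⟨![0, ↑u⁻¹ * y], by simp [f, ← mul_assoc, show m[i.1].2 = u from hu.symm]⟩
  have key : ∀ p ∈ m, IsUnit (p.1 * v 0 + p.2 * v 1) := by
    intro p hp
    obtain ⟨i, hi, rfl⟩ := List.mem_iff_getElem.mp hp
    simpa [f] using hv ⟨i, hi⟩
  obtain ⟨x, hx⟩ : IsUnit (v 0) := by simpa using key (1, 0) (by simp [m])
  obtain ⟨y, hy⟩ : IsUnit (v 1) := by simpa using key (0, 1) (by simp [m])
  refine ⟨x * y⁻¹, fun p hp => ?_⟩
  have h := (key p (by simp [m, hp])).mul (y⁻¹).isUnit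
  rw [← hx, ← hy] at h
  convert h using 1
  rw [add_mul, mul_assoc p.2, Units.mul_inv]
  push_cast
  ring

/-- The relation between the classes `F a b = [a, b]` imposed by the boundary of the frame
`(e₁, e₂, a₁e₁ + a₂e₂, a₁s e₁ + a₂t e₂)`. -/
def FrameRelation {A : Type} [AddCommGroup A] (F : Rˣ → Rˣ → A) : Prop :=
  ∀ a₁ a₂ s t d : Rˣ, (d : R) = s - t →
    F (a₁ * s) (a₂ * t) - F a₁ a₂ = F (a₁ * d) t - F (a₂ * -d) s

/-- Steinberg symbols on `R` with values in `A`. -/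
structure IsSteinbergSymbol {A : Type} [AddCommGroup A] (L : Rˣ → Rˣ → A) : Prop where
  mul_left : ∀ a b c, L (a * b) c = L a c + L b c
  mul_right : ∀ a b c, L a (b * c) = L a b + L a c
  one_sub : ∀ a b : Rˣ, (b : R) = 1 - a → L a b = 0

namespace IsSteinbergSymbol

variable {A : Type} [AddCommGroup A] {L : Rˣ → Rˣ → A}

theorem one_left (h : IsSteinbergSymbol L) (a : Rˣ) : L 1 a = 0 := by
  simpa using h.mul_left 1 1 a

theorem one_right (h : IsSteinbergSymbol L) (a : Rˣ) : L a 1 = 0 := by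
  simpa using h.mul_right a 1 1

theorem inv_left (h : IsSteinbergSymbol L) (a b : Rˣ) : L a⁻¹ b = - L a b := by
  have := h.mul_left a⁻¹ a b
  rw [inv_mul_cancel, h.one_left] at this
  exact eq_neg_of_add_eq_zero_left this.symm

theorem inv_right (h : IsSteinbergSymbol L) (a b : Rˣ) : L a b⁻¹ = - L a b := by
  have := h.mul_right a b⁻¹ b
  rw [inv_mul_cancel, h.one_right] at this
  exact eq_neg_of_add_eq_zero_left this.symm

theorem self_neg_of_isUnit (h : IsSteinbergSymbol L) (a : Rˣ) (ha : IsUnit ((a : R) - 1)) :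
    L a (-a) = 0 := by
  obtain ⟨u, hu⟩ := ha
  have h1 : L a (-u) = 0 := h.one_sub _ _ (by simp [hu])
  have h2 : L a⁻¹ (a⁻¹ * u) = 0 := h.one_sub _ _ (by simp [hu, mul_sub])
  have h3 : -a = -u * (a⁻¹ * u)⁻¹ := by
    rw [mul_inv_rev, inv_inv, neg_mul, mul_inv_cancel_left]
  rw [h.inv_left, neg_eq_zero] at h2
  rw [h3, h.mul_right, h.inv_right, h1, h2]
  simp

theorem self_neg (hR : ManyUnits R) (h : IsSteinbergSymbol L) (a : Rˣ) : L a (-a) = 0 := by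
  have key : ∀ u : Rˣ, IsUnit ((u : R) - 1) → IsUnit (((a * u : Rˣ) : R) - 1) →
      L a (-a) + (L a u + L u a) = 0 := by
    intro u hu hau
    have h1 := h.self_neg_of_isUnit u hu
    have h2 := h.self_neg_of_isUnit _ hau
    have h3 := h.mul_left a u (-(a * u))
    have h4 := h.mul_right a (-a) u
    have h5 := h.mul_right u (-u) a
    rw [neg_mul] at h4 h5
    rw [mul_comm u a] at h5
    rw [h3, h4, h5, h1] at h2
    rw [← h2]
    abel
  obtain ⟨u, hu⟩ := hR.exists_unit [(1, -1), ((a : R), -1)] (by simp)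
  obtain ⟨v, hv⟩ := hR.exists_unit
    [(1, -1), ((u : R), -1), ((a : R), -1), (((a * u : Rˣ) : R), -1)] (by simp)
  simp only [List.mem_cons, List.not_mem_nil, or_false, forall_eq_or_imp, forall_eq,
    one_mul, ← sub_eq_add_neg, ← Units.val_mul] at hu hv
  have h1 := key u hu.1 hu.2
  have h2 := key v hv.1 hv.2.2.1
  have h3 := key (u * v) hv.2.1 (by rw [← mul_assoc]; exact hv.2.2.2)
  rw [h.mul_left, h.mul_right] at h3
  have h4 : L a (-a) = (L a (-a) + (L a u + L u a)) + (L a (-a) + (L a v + L v a))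
      - (L a (-a) + (L a u + L a v + (L u a + L v a))) := by abel
  rw [h4, h1, h2, h3]
  simp

theorem antisymm (hR : ManyUnits R) (h : IsSteinbergSymbol L) (a b : Rˣ) :
    L a b + L b a = 0 := by
  have h1 := h.self_neg hR (a * b)
  have h2 := h.mul_right a (-a) b
  have h3 := h.mul_right b (-b) a
  rw [neg_mul] at h2 h3
  rw [mul_comm b a] at h3
  rw [h.mul_left, h2, h3, h.self_neg hR, h.self_neg hR, zero_add, zero_add] at h1
  exact h1

theorem frameRelation (hR : ManyUnits R) (h : IsSteinbergSymbol L) : FrameRelation L := by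
  intro a₁ a₂ s t d hd
  obtain ⟨u, rfl⟩ : ∃ u, t = s * u := ⟨s⁻¹ * t, by simp⟩
  obtain ⟨e, rfl⟩ : ∃ e, d = s * e := ⟨s⁻¹ * d, by simp⟩
  have he : (u : R) = 1 - e := by
    apply s.isUnit.mul_left_cancel
    push_cast at hd
    rw [mul_sub, hd]
    ring
  have h1 := h.one_sub e u he
  have h2 := h.self_neg hR s
  have h3 := h.antisymm hR s a₂
  have h4 : L (-s) s = 0 := by
    have h5 := h.antisymm hR s (-s)
    rwa [h2, zero_add] at h5
  have h6 := h.antisymm hR e s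
  rw [← neg_mul]
  simp only [h.mul_left, h.mul_right]
  rw [h1, h4]
  have h7 : L s a₂ = - L a₂ s := eq_neg_of_add_eq_zero_left h3
  rw [h7]
  abel

end IsSteinbergSymbol

namespace FrameRelation

variable {A : Type} [AddCommGroup A] {F : Rˣ → Rˣ → A}

theorem diff_add (h : FrameRelation F) (r b x y z : Rˣ) (hz : (z : R) = x + y) :
    F (r * z) b - F z b - (F (r * y) b - F y b) = F (r * x) 1 - F x 1 := by
  have hd : ((x * y⁻¹ : Rˣ) : R) = ((z * y⁻¹ : Rˣ) : R) - ((1 : Rˣ) : R) := by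
    push_cast
    rw [hz, add_mul, Units.mul_inv]
    ring
  have h1 := h (r * y) b (z * y⁻¹) 1 (x * y⁻¹) hd
  have h2 := h y b (z * y⁻¹) 1 (x * y⁻¹) hd
  rw [show r * y * (z * y⁻¹) = r * z by rw [mul_assoc, mul_comm z, mul_inv_cancel_left],
    show r * y * (x * y⁻¹) = r * x by rw [mul_assoc, mul_comm x, mul_inv_cancel_left],
    mul_one] at h1
  rw [mul_comm z, mul_inv_cancel_left, mul_comm x, mul_inv_cancel_left, mul_one] at h2
  grind

theorem diff_indep (hR : ManyUnits R) (h : FrameRelation F) (r b x y : Rˣ) :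
    F (r * x) b - F x b - (F (r * x) 1 - F x 1) =
      F (r * y) b - F y b - (F (r * y) 1 - F y 1) := by
  have key : ∀ x y : Rˣ, IsUnit ((y : R) + x) →
      F (r * x) b - F x b - (F (r * x) 1 - F x 1) =
        F (r * y) b - F y b - (F (r * y) 1 - F y 1) := by
    rintro x y ⟨z, hz⟩
    have h1 := h.diff_add r b x y z (by rw [hz, add_comm])
    have h2 := h.diff_add r b y x z hz
    grind
  obtain ⟨w, hw⟩ := hR.exists_unit [(1, (x : R)), (1, (y : R))] (by simp)
  simp only [List.mem_cons, List.not_mem_nil, or_false, forall_eq_or_imp, forall_eq,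
    one_mul] at hw
  rw [key x w hw.1, key y w hw.2]

theorem apply_one (hR : ManyUnits R) (h : FrameRelation F) (r x : Rˣ) :
    F (r * x) 1 = F x 1 := by
  have const : ∀ a t : Rˣ, F (r * a) 1 - F a 1 = F (r * (a * t)) 1 - F (a * t) 1 := by
    intro a t
    obtain ⟨s, hs⟩ := hR.exists_unit [(1, -(t : R))] (by simp)
    simp only [List.mem_singleton, forall_eq, one_mul, ← sub_eq_add_neg] at hs
    obtain ⟨d, hd⟩ := hs
    have h1 := h (r * a) 1 s t d hd
    have h2 := h a 1 s t d hd
    have h3 := h.diff_indep hR r t (a * s) (a * d)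
    have h4 := h.diff_add r 1 (a * d) (a * t) (a * s) (by push_cast; rw [hd]; ring)
    rw [one_mul] at h1 h2
    rw [mul_assoc, mul_assoc] at h1
    grind
  obtain ⟨y, hy⟩ := hR.exists_unit [(1, (x : R))] (by simp)
  simp only [List.mem_singleton, forall_eq, one_mul] at hy
  obtain ⟨z, hz⟩ := hy
  have h1 := h.diff_add r 1 y x z hz
  have h2 := const x (x⁻¹ * y)
  have h3 := const x (x⁻¹ * z)
  rw [mul_inv_cancel_left] at h2 h3
  grind

theorem mul_left (hR : ManyUnits R) (h : FrameRelation F) (r x b : Rˣ) :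
    F (r * x) b = F r b + F x b - F 1 b := by
  have h1 := h.diff_indep hR r b x 1
  have h2 := h.apply_one hR r x
  have h3 := h.apply_one hR r 1
  rw [mul_one] at h1 h3
  grind

theorem isSteinbergSymbol_sub_one (hR : ManyUnits R) (h : FrameRelation F) :
    IsSteinbergSymbol fun a b => F a b - F 1 b := by
  refine ⟨fun a b c => ?_, fun a b c => ?_, fun u v huv => ?_⟩
  · have := h.mul_left hR a b c
    grind
  · obtain ⟨s, hs⟩ := hR.exists_unit [(1, -(c : R))] (by simp)
    simp only [List.mem_singleton, forall_eq, one_mul, ← sub_eq_add_neg] at hs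
    obtain ⟨d, hd⟩ := hs
    have h1 := h a b s c d hd
    have h2 := h 1 b s c d hd
    rw [h.mul_left hR] at h1
    rw [h.mul_left hR a d] at h1
    rw [one_mul, one_mul] at h2
    grind
  · have h1 := h 1 1 1 v u (by rw [huv]; simp)
    have h2 := h.mul_left hR (-1) u 1
    simp only [one_mul] at h1 h2
    have h3 := h.apply_one hR (-u) 1
    rw [mul_one] at h3
    grind

theorem apply_one_left (hR : ManyUnits R) (h : FrameRelation F) (b : Rˣ) : F 1 b = F 1 1 := by
  have hL := h.isSteinbergSymbol_sub_one hR
  obtain ⟨u, hu⟩ := hR.exists_unit [(-1, 1)] (by simp)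
  simp only [List.mem_singleton, forall_eq] at hu
  obtain ⟨d, hd⟩ := hu
  have h1 := h 1 1 b (b * u) (b * d) (by push_cast; rw [hd]; ring)
  have h2 := hL.frameRelation hR 1 1 b (b * u) (b * d) (by push_cast; rw [hd]; ring)
  grind

theorem isSteinbergSymbol (hR : ManyUnits R) (h : FrameRelation F) :
    IsSteinbergSymbol fun a b => F a b - F 1 1 := by
  have := h.isSteinbergSymbol_sub_one hR
  simpa only [h.apply_one_left hR] using this

end FrameRelation

end Symbols

section Frames

variable {R : Type} [CommRing R]

/-- The determinant of the pair of vectors `v, w`. -/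
def detPair (v w : V2 R) : R := v 0 * w 1 - v 1 * w 0

theorem isBDS_pair_iff (v : Fin 2 → V2 R) : IsBDS R v ↔ IsUnit (detPair (v 0) (v 1)) := by
  have hdet : detPair (v 0) (v 1) = (Pi.basisFun R (Fin 2)).det v := by
    rw [Pi.basisFun_det_apply, Matrix.det_fin_two, detPair]
    rfl
  rw [hdet, ← Module.Basis.is_basis_iff_det]
  refine and_congr_right fun hv => ⟨?_, fun h => ⟨⊥, by rw [h]; exact isCompl_top_bot⟩⟩
  rintro ⟨N, hN⟩
  let b := Module.Basis.span hv
  let π := b.equivFun.toLinearMap ∘ₗ Submodule.projectionOnto _ N hN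
  have hsurj : Function.Surjective π :=
    b.equivFun.surjective.comp (Submodule.projectionOnto_surjective hN)
  have hinj : Function.Injective π := OrzechProperty.injective_of_surjective_endomorphism π hsurj
  have hbot : N = ⊥ := by
    rw [eq_bot_iff]
    intro x hx
    have : π x = 0 := by
      rw [LinearMap.comp_apply, (Submodule.projectionOnto_apply_eq_zero_iff hN).mpr hx, map_zero]
    exact hinj (this.trans (map_zero π).symm)
  simpa [hbot] using hN.sup_eq_top

theorem isFrame_iff {l : ℕ} (v : Tup R (l + 1)) :
    IsFrame R v ↔ ∀ i j, i ≠ j → IsUnit (detPair (v i) (v j)) := by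
  have hm : min (l + 1 + 1) 2 = 2 := by omega
  unfold IsFrame
  rw [hm]
  constructor
  · intro h i j hij
    have hinj : Function.Injective ![i, j] := by
      intro x y
      fin_cases x <;> fin_cases y <;> simp [hij, hij.symm]
    simpa using (isBDS_pair_iff _).mp (h ![i, j] hinj)
  · intro h ι hι
    exact (isBDS_pair_iff _).mpr (h _ _ (hι.ne (by decide)))

theorem IsFrame.face {l : ℕ} {v : Tup R (l + 2)} (hv : IsFrame R v) (i : Fin (l + 3)) :
    IsFrame R (l := l + 1) (v ∘ i.succAbove) := by
  rw [isFrame_iff] at hv ⊢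
  exact fun j k hjk => hv _ _ (Fin.succAbove_right_injective.ne hjk)

theorem detPair_mulVec (g : Matrix (Fin 2) (Fin 2) R) (v w : V2 R) :
    detPair (g.mulVec v) (g.mulVec w) = g.det * detPair v w := by
  simp only [detPair, Matrix.mulVec, dotProduct, Fin.sum_univ_two, Matrix.det_fin_two]
  ring

theorem IsFrame.gT {l : ℕ} {v : Tup R (l + 1)} (hv : IsFrame R v) (g : GL (Fin 2) R) :
    IsFrame R (gT R g v) := by
  rw [isFrame_iff] at hv ⊢
  intro i j hij
  have := detPair_mulVec (g : Matrix (Fin 2) (Fin 2) R) (v i) (v j)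
  exact this ▸ ((Matrix.isUnit_iff_isUnit_det _).mp g.isUnit).mul (hv i j hij)

/-- The identity `det(u, w) v = det(v, w) u + det(u, v) w`. -/
theorem detPair_smul (u v w : V2 R) :
    detPair u w • v = detPair v w • u + detPair u v • w := by
  ext i
  fin_cases i <;> simp [detPair] <;> ring

theorem exists_units_of_isFrame {u w v : V2 R} (h₁ : IsUnit (detPair u w))
    (h₂ : IsUnit (detPair v w)) (h₃ : IsUnit (detPair u v)) :
    ∃ a b : Rˣ, v = a • u + b • w := by
  obtain ⟨x, hx⟩ := h₁
  obtain ⟨y, hy⟩ := h₂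
  obtain ⟨z, hz⟩ := h₃
  refine ⟨x⁻¹ * y, x⁻¹ * z, ?_⟩
  have := detPair_smul u v w
  rw [← hx, ← hy, ← hz] at this
  rw [mul_smul, mul_smul, ← smul_add, eq_inv_smul_iff]
  exact this

theorem units_unique {u w : V2 R} (h : IsUnit (detPair u w)) {a b c d : Rˣ}
    (he : a • u + b • w = c • u + d • w) : a = c ∧ b = d := by
  have h0 := congrFun he 0
  have h1 := congrFun he 1
  simp only [Pi.add_apply, Pi.smul_apply, Units.smul_def, smul_eq_mul] at h0 h1
  constructor
  · ext
    apply h.mul_left_cancel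
    simp only [detPair]
    linear_combination w 1 * h0 - w 0 * h1
  · ext
    apply h.mul_left_cancel
    simp only [detPair]
    linear_combination u 0 * h1 - u 1 * h0

end Frames

section Complex

variable {R : Type} [CommRing R]

theorem mem_DD {l : ℕ} {x : EE R l} : x ∈ DD R l ↔ ∀ v ∈ x.support, IsFrame R v := by
  rw [DD, Submodule.mem_toAddSubgroup, Finsupp.mem_supported]
  rfl

theorem single_mem_DD {l : ℕ} {v : Tup R l} (hv : IsFrame R v) (n : ℤ) :
    Finsupp.single v n ∈ DD R l := by
  rw [mem_DD]
  intro w hw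
  rwa [Finset.mem_singleton.mp (Finsupp.support_single_subset hw)]

theorem DD_le {l : ℕ} {K : AddSubgroup (EE R l)}
    (h : ∀ v, IsFrame R v → Finsupp.single v 1 ∈ K) : DD R l ≤ K := by
  intro x hx
  rw [← Finsupp.sum_single x]
  refine K.sum_mem fun v hv => ?_
  have := K.zsmul_mem (h v (mem_DD.mp hx v hv)) (x v)
  rwa [Finsupp.smul_single, smul_eq_mul, mul_one] at this

theorem EE_hom_ext {l : ℕ} {A : Type*} [AddCommGroup A] {f g : EE R l →+ A}
    (h : ∀ v, f (Finsupp.single v 1) = g (Finsupp.single v 1)) : f = g := by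
  ext v
  exact h v

theorem bdE_single {l : ℕ} (v : Tup R (l + 1)) :
    bdE R l (Finsupp.single v 1) =
      ∑ i : Fin (l + 2), (-1 : ℤ) ^ (i : ℕ) • Finsupp.single (v ∘ i.succAbove) 1 := by
  simp [bdE]

theorem bdE_zero_single (x y : V2 R) :
    bdE R 0 (Finsupp.single ![x, y] 1) = Finsupp.single ![y] 1 - Finsupp.single ![x] 1 := by
  have h0 : ![x, y] ∘ (0 : Fin 2).succAbove = ![y] := by ext i; fin_cases i; rfl
  have h1 : ![x, y] ∘ (1 : Fin 2).succAbove = ![x] := by ext i; fin_cases i; rfl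
  rw [bdE_single, Fin.sum_univ_two, h0, h1]
  simp [sub_eq_add_neg]

theorem bdE_one_single (x y z : V2 R) :
    bdE R 1 (Finsupp.single ![x, y, z] 1) =
      Finsupp.single ![y, z] 1 - Finsupp.single ![x, z] 1 + Finsupp.single ![x, y] 1 := by
  have h0 : ![x, y, z] ∘ (0 : Fin 3).succAbove = ![y, z] := by ext i; fin_cases i <;> rfl
  have h1 : ![x, y, z] ∘ (1 : Fin 3).succAbove = ![x, z] := by ext i; fin_cases i <;> rfl
  have h2 : ![x, y, z] ∘ (2 : Fin 3).succAbove = ![x, y] := by ext i; fin_cases i <;> rfl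
  rw [bdE_single, Fin.sum_univ_three, h0, h1, h2]
  simp [sub_eq_add_neg]

theorem bdE_two_single (x y z w : V2 R) :
    bdE R 2 (Finsupp.single ![x, y, z, w] 1) =
      Finsupp.single ![y, z, w] 1 - Finsupp.single ![x, z, w] 1
        + Finsupp.single ![x, y, w] 1 - Finsupp.single ![x, y, z] 1 := by
  have h0 : ![x, y, z, w] ∘ (0 : Fin 4).succAbove = ![y, z, w] := by
    ext i; fin_cases i <;> rfl
  have h1 : ![x, y, z, w] ∘ (1 : Fin 4).succAbove = ![x, z, w] := by
    ext i; fin_cases i <;> rfl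
  have h2 : ![x, y, z, w] ∘ (2 : Fin 4).succAbove = ![x, y, w] := by
    ext i; fin_cases i <;> rfl
  have h3 : ![x, y, z, w] ∘ (3 : Fin 4).succAbove = ![x, y, z] := by
    ext i; fin_cases i <;> rfl
  rw [bdE_single, Fin.sum_univ_four, h0, h1, h2, h3]
  simp [sub_eq_add_neg, pow_succ]

theorem tup_two_eta (v : Tup R 2) : v = ![v 0, v 1, v 2] := by
  ext i; fin_cases i <;> rfl

theorem tup_three_eta (v : Tup R 3) : v = ![v 0, v 1, v 2, v 3] := by
  ext i; fin_cases i <;> rfl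

theorem bdE_zero_bdE_one (x : EE R 2) : bdE R 0 (bdE R 1 x) = 0 := by
  suffices (bdE R 0).comp (bdE R 1) = 0 from DFunLike.congr_fun this x
  refine EE_hom_ext fun v => ?_
  rw [tup_two_eta v, AddMonoidHom.comp_apply, bdE_one_single, map_add, map_sub]
  simp only [bdE_zero_single, AddMonoidHom.zero_apply]
  abel

theorem bdE_one_bdE_two (x : EE R 3) : bdE R 1 (bdE R 2 x) = 0 := by
  suffices (bdE R 1).comp (bdE R 2) = 0 from DFunLike.congr_fun this x
  refine EE_hom_ext fun v => ?_
  rw [tup_three_eta v, AddMonoidHom.comp_apply, bdE_two_single, map_sub, map_add, map_sub]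
  simp only [bdE_one_single, AddMonoidHom.zero_apply]
  abel

theorem bdE_mem_DD {l : ℕ} {x : EE R (l + 2)} (hx : x ∈ DD R (l + 2)) :
    bdE R (l + 1) x ∈ DD R (l + 1) := by
  suffices DD R (l + 2) ≤ (DD R (l + 1)).comap (bdE R (l + 1)) from this hx
  refine DD_le fun v hv => ?_
  rw [AddSubgroup.mem_comap, bdE_single]
  exact sum_mem fun i _ => zsmul_mem (single_mem_DD (hv.face i) 1) _

theorem mapDomain_gT_mem_DD {l : ℕ} (g : GL (Fin 2) R) {x : EE R (l + 1)}
    (hx : x ∈ DD R (l + 1)) : Finsupp.mapDomain (gT R g) x ∈ DD R (l + 1) := by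
  suffices DD R (l + 1) ≤
      (DD R (l + 1)).comap (Finsupp.mapDomain.addMonoidHom (gT R g)) from this hx
  refine DD_le fun v hv => ?_
  rw [AddSubgroup.mem_comap, Finsupp.mapDomain.addMonoidHom_apply, Finsupp.mapDomain_single]
  exact single_mem_DD (hv.gT g) 1

theorem bdE_mapDomain_gT {l : ℕ} (g : GL (Fin 2) R) (x : EE R (l + 1)) :
    bdE R l (Finsupp.mapDomain (gT R g) x) = Finsupp.mapDomain (gT R g) (bdE R l x) := by
  suffices (bdE R l).comp (Finsupp.mapDomain.addMonoidHom (gT R g)) =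
      (Finsupp.mapDomain.addMonoidHom (gT R g)).comp (bdE R l) from DFunLike.congr_fun this x
  refine EE_hom_ext fun v => ?_
  simp only [AddMonoidHom.comp_apply, Finsupp.mapDomain.addMonoidHom_apply,
    Finsupp.mapDomain_single, bdE_single, Finsupp.mapDomain_finsetSum, Finsupp.mapDomain_smul]
  rfl

/-- The cone operator `(v₀, …, v_l) ↦ (w, v₀, …, v_l)`. -/
noncomputable def cone {l : ℕ} (w : V2 R) : EE R l →+ EE R (l + 1) :=
  Finsupp.mapDomain.addMonoidHom (Fin.cons (α := fun _ => V2 R) w)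

theorem cone_single {l : ℕ} (w : V2 R) (v : Tup R l) (n : ℤ) :
    cone w (Finsupp.single v n) =
      Finsupp.single (Fin.cons (α := fun _ => V2 R) w v : Tup R (l + 1)) n := by
  rw [cone, Finsupp.mapDomain.addMonoidHom_apply, Finsupp.mapDomain_single]

theorem bdE_cone {l : ℕ} (w : V2 R) (x : EE R (l + 1)) :
    bdE R (l + 1) (cone w x) = x - cone w (bdE R l x) := by
  suffices (bdE R (l + 1)).comp (cone w) =
      AddMonoidHom.id _ - (cone w).comp (bdE R l) from DFunLike.congr_fun this x
  refine EE_hom_ext fun v => ?_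
  have h : ∀ i : Fin (l + 2),
      (Fin.cons (α := fun _ => V2 R) w v : Tup R (l + 2)) ∘ i.succ.succAbove =
        (Fin.cons (α := fun _ => V2 R) w (v ∘ i.succAbove) : Tup R (l + 1)) := by
    intro i
    funext j
    refine Fin.cases ?_ (fun j => ?_) j
    · simp
    · simp [Fin.succ_succAbove_succ]
  simp only [AddMonoidHom.comp_apply, AddMonoidHom.sub_apply, AddMonoidHom.id_apply,
    cone_single, bdE_single, map_sum, map_zsmul]
  rw [Fin.sum_univ_succ]
  simp only [h, Fin.val_succ, pow_succ, Fin.val_zero, pow_zero, one_smul, mul_neg, mul_one,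
    neg_smul, Finset.sum_neg_distrib, sub_eq_add_neg, Fin.succAbove_zero]
  rfl

theorem detPair_swap (v w : V2 R) : detPair v w = - detPair w v := by
  simp only [detPair]
  ring

theorem ManyUnits.exists_cone_mem_DD (hR : ManyUnits R) {l : ℕ} {x : EE R (l + 1)}
    (hx : x ∈ DD R (l + 1)) : ∃ w : V2 R, cone w x ∈ DD R (l + 2) := by
  let m : List (V2 R) := (x.support ×ˢ Finset.univ).toList.map fun p => p.1 p.2
  obtain ⟨w, hw⟩ := hR 2 le_rfl m.length
    (fun k => m[k] 1 • LinearMap.proj 0 - m[k] 0 • LinearMap.proj 1) fun k => by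
      obtain ⟨⟨v, i⟩, hv, hvi⟩ := List.mem_map.mp (List.getElem_mem k.2 : m[k] ∈ m)
      simp only [Finset.mem_toList, Finset.mem_product, Finset.mem_univ, and_true] at hv
      obtain ⟨j, hj⟩ := exists_ne i
      obtain ⟨u, hu⟩ := (isFrame_iff v).mp (mem_DD.mp hx v hv) j i hj
      simp only at hvi
      rw [hvi] at hu
      intro y
      refine ⟨(↑u⁻¹ * y) • v j, ?_⟩
      have : (↑u⁻¹ * y) * detPair (v j) m[k] = y := by
        rw [Fin.getElem_fin, ← hu, mul_right_comm, Units.inv_mul, one_mul]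
      simp only [LinearMap.sub_apply, LinearMap.smul_apply, LinearMap.proj_apply,
        Pi.smul_apply, smul_eq_mul]
      rw [detPair] at this
      linear_combination this
  have key : ∀ v ∈ x.support, ∀ i, IsUnit (detPair w (v i)) := by
    intro v hv i
    have hmem : v i ∈ m := List.mem_map.mpr ⟨(v, i), by simpa using hv, rfl⟩
    obtain ⟨k, hk, hvk⟩ := List.mem_iff_getElem.mp hmem
    convert hw ⟨k, hk⟩ using 1
    simp only [LinearMap.sub_apply, LinearMap.smul_apply, LinearMap.proj_apply,
      smul_eq_mul, Fin.getElem_fin, hvk, detPair]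
    ring
  refine ⟨w, ?_⟩
  rw [← Finsupp.sum_single x, Finsupp.sum, map_sum]
  refine sum_mem fun v hv => ?_
  rw [cone_single]
  refine single_mem_DD ((isFrame_iff _).mpr fun i j => ?_) _
  have hv' := (isFrame_iff v).mp (mem_DD.mp hx v hv)
  refine Fin.cases ?_ (fun i => ?_) i <;> refine Fin.cases ?_ (fun j => ?_) j
  · simp
  · exact fun _ => key v hv j
  · intro _
    rw [detPair_swap]
    exact (key v hv i).neg
  · exact fun hij => hv' i j fun h => hij (by rw [h])

/-- Exactness of the complex `D_*(R²)` in positive degrees. -/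
theorem ManyUnits.exists_bdE_eq (hR : ManyUnits R) {l : ℕ} {x : EE R (l + 1)}
    (hx : x ∈ DD R (l + 1)) (h0 : bdE R l x = 0) :
    ∃ y ∈ DD R (l + 2), bdE R (l + 1) y = x := by
  obtain ⟨w, hw⟩ := hR.exists_cone_mem_DD hx
  exact ⟨_, hw, by rw [bdE_cone, h0, map_zero, sub_zero]⟩

end Complex

section Coinvariants

variable {R : Type} [CommRing R]

variable (R) in
/-- The group of cycles `ker(∂₁ : D₁(R²) → D₀(R²))`. -/
noncomputable abbrev Cycles : AddSubgroup (EE R 1) := DD R 1 ⊓ (bdE R 0).ker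

variable (R) in
/-- The boundary `∂₂ : D₂(R²) → ker ∂₁` followed by the projection to the coinvariants. -/
noncomputable def boundaryClass : DD R 2 →+ H0 R 1 (Cycles R) :=
  (QuotientAddGroup.mk' _).comp
    (((bdE R 1).comp (DD R 2).subtype).codRestrict (Cycles R) fun x =>
      ⟨bdE_mem_DD x.2, bdE_zero_bdE_one _⟩)

theorem boundaryClass_apply (d : DD R 2) (p : Cycles R) (h : (p : EE R 1) = bdE R 1 d) :
    boundaryClass R d = QuotientAddGroup.mk p :=
  congrArg QuotientAddGroup.mk (Subtype.ext h.symm)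

theorem boundaryClass_mapDomain (g : GL (Fin 2) R) (d : DD R 2) :
    boundaryClass R ⟨Finsupp.mapDomain (gT R g) d, mapDomain_gT_mem_DD g d.2⟩ =
      boundaryClass R d := by
  refine (QuotientAddGroup.eq.mpr ?_).symm
  rw [AddSubgroup.mem_addSubgroupOf]
  refine AddSubgroup.subset_closure ⟨g, bdE R 1 d, ⟨bdE_mem_DD d.2, bdE_zero_bdE_one _⟩, ?_⟩
  rw [← bdE_mapDomain_gT, sub_eq_neg_add]
  rfl

theorem boundaryClass_surjective (hR : ManyUnits R) :
    Function.Surjective (boundaryClass R) := by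
  rintro ⟨p⟩
  obtain ⟨d, hd, hdp⟩ := hR.exists_bdE_eq p.2.1 p.2.2
  exact ⟨⟨d, hd⟩, boundaryClass_apply _ _ hdp.symm⟩

theorem isFrame_triple_iff (x y z : V2 R) : IsFrame R (l := 2) ![x, y, z] ↔
    IsUnit (detPair x y) ∧ IsUnit (detPair x z) ∧ IsUnit (detPair y z) := by
  rw [isFrame_iff]
  constructor
  · intro h
    exact ⟨h 0 1 (by decide), h 0 2 (by decide), h 1 2 (by decide)⟩
  · rintro ⟨h1, h2, h3⟩ i j hij
    fin_cases i <;> fin_cases j <;>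
      first
      | exact absurd rfl hij
      | assumption
      | (rw [detPair_swap, IsUnit.neg_iff]; assumption)

theorem isFrame_smul_add (x y : V2 R) (a b : Rˣ) (h : IsUnit (detPair x y)) :
    IsFrame R (l := 2) ![x, y, a • x + b • y] := by
  refine (isFrame_triple_iff _ _ _).mpr ⟨h, ?_, ?_⟩
  · convert b.isUnit.mul h using 1
    simp only [detPair, Pi.add_apply, Pi.smul_apply, Units.smul_def, smul_eq_mul]
    ring
  · convert (a.isUnit.mul h).neg using 1
    simp only [detPair, Pi.add_apply, Pi.smul_apply, Units.smul_def, smul_eq_mul]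
    ring

theorem IsFrame.exists_eq {v : Tup R 2} (hv : IsFrame R v) :
    ∃ (x y : V2 R) (a b : Rˣ), IsUnit (detPair x y) ∧ v = ![x, y, a • x + b • y] := by
  rw [tup_two_eta v] at hv
  obtain ⟨h1, h2, h3⟩ := (isFrame_triple_iff _ _ _).mp hv
  obtain ⟨a, b, hab⟩ := exists_units_of_isFrame h1 (by rw [detPair_swap]; exact h3.neg) h2
  exact ⟨v 0, v 1, a, b, h1, by rw [← hab]; exact tup_two_eta v⟩

theorem smul_add_eq (a b : Rˣ) :
    a • (![1, 0] : V2 R) + b • (![0, 1] : V2 R) = ![(a : R), (b : R)] := by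
  simp [Units.smul_def]

variable (R) in
theorem isUnit_detPair_std : IsUnit (detPair (![1, 0] : V2 R) ![0, 1]) := by
  simp [detPair]

theorem isFrame_std (a b : Rˣ) :
    IsFrame R (l := 2) ![![1, 0], ![0, 1], ![(a : R), (b : R)]] := by
  rw [← smul_add_eq]
  exact isFrame_smul_add _ _ a b (isUnit_detPair_std R)

/-- The class `[a, b]` of the boundary of `(e₁, e₂, a e₁ + b e₂)`. -/
noncomputable def bracket (a b : Rˣ) : H0 R 1 (Cycles R) :=
  boundaryClass R ⟨_, single_mem_DD (isFrame_std a b) 1⟩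

theorem boundaryClass_single {x y z : V2 R} {a b : Rˣ} (h : IsUnit (detPair x y))
    (hz : z = a • x + b • y) (hv : Finsupp.single ![x, y, z] 1 ∈ DD R 2) :
    boundaryClass R ⟨_, hv⟩ = bracket a b := by
  subst hz
  let M : Matrix (Fin 2) (Fin 2) R := !![x 0, y 0; x 1, y 1]
  have hM : IsUnit M := by
    rw [Matrix.isUnit_iff_isUnit_det, Matrix.det_fin_two_of]
    convert h using 1
    simp only [detPair]
    ring
  refine Eq.trans ?_ (boundaryClass_mapDomain hM.unit _)
  congr 2
  rw [Finsupp.mapDomain_single]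
  congr 1
  ext i j
  fin_cases i <;> fin_cases j <;>
    simp [gT, M, Matrix.mulVec, dotProduct, Fin.sum_univ_two, Units.smul_def, mul_comm]

theorem smul_add_eq_left (x y : V2 R) {a₁ a₂ s t d : Rˣ} (hd : (d : R) = s - t) :
    (a₁ * s) • x + (a₂ * t) • y = (a₂ * -d) • y + s • (a₁ • x + a₂ • y) := by
  ext i
  simp only [Pi.add_apply, Pi.smul_apply, Units.smul_def, smul_eq_mul,
    Units.val_mul, Units.val_neg, hd]
  ring

theorem smul_add_eq_right (x y : V2 R) {a₁ a₂ s t d : Rˣ} (hd : (d : R) = s - t) :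
    (a₁ * s) • x + (a₂ * t) • y = (a₁ * d) • x + t • (a₁ • x + a₂ • y) := by
  ext i
  simp only [Pi.add_apply, Pi.smul_apply, Units.smul_def, smul_eq_mul,
    Units.val_mul, hd]
  ring

theorem isUnit_detPair_left {x y : V2 R} {a b : Rˣ} (h : IsUnit (detPair x y)) :
    IsUnit (detPair x (a • x + b • y)) :=
  ((isFrame_triple_iff _ _ _).mp (isFrame_smul_add x y a b h)).2.1

theorem isUnit_detPair_right {x y : V2 R} {a b : Rˣ} (h : IsUnit (detPair x y)) :
    IsUnit (detPair y (a • x + b • y)) :=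
  ((isFrame_triple_iff _ _ _).mp (isFrame_smul_add x y a b h)).2.2

variable (R) in
theorem frameRelation_bracket : FrameRelation (bracket (R := R)) := by
  intro a₁ a₂ s t d hd
  set x : V2 R := ![1, 0]
  set y : V2 R := ![0, 1]
  have h : IsUnit (detPair x y) := isUnit_detPair_std R
  set z := a₁ • x + a₂ • y with hz
  set w := (a₁ * s) • x + (a₂ * t) • y with hw
  have hw1 : w = (a₂ * -d) • y + s • z := smul_add_eq_left x y hd
  have hw2 : w = (a₁ * d) • x + t • z := smul_add_eq_right x y hd
  have m0 : Finsupp.single ![y, z, w] 1 ∈ DD R 2 :=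
    single_mem_DD (hw1 ▸ isFrame_smul_add y z _ _ (isUnit_detPair_right h)) 1
  have m1 : Finsupp.single ![x, z, w] 1 ∈ DD R 2 :=
    single_mem_DD (hw2 ▸ isFrame_smul_add x z _ _ (isUnit_detPair_left h)) 1
  have m2 : Finsupp.single ![x, y, w] 1 ∈ DD R 2 :=
    single_mem_DD (isFrame_smul_add x y _ _ h) 1
  have m3 : Finsupp.single ![x, y, z] 1 ∈ DD R 2 :=
    single_mem_DD (isFrame_smul_add x y _ _ h) 1
  have e0 := boundaryClass_single (isUnit_detPair_right h) hw1 m0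
  have e1 := boundaryClass_single (isUnit_detPair_left h) hw2 m1
  have e2 := boundaryClass_single h hw m2
  have e3 := boundaryClass_single h hz m3
  have hsum : boundaryClass R (⟨_, m0⟩ - ⟨_, m1⟩ + ⟨_, m2⟩ - ⟨_, m3⟩) = 0 := by
    refine boundaryClass_apply _ 0 ?_
    have := bdE_one_bdE_two (Finsupp.single ![x, y, z, w] 1)
    rw [bdE_two_single] at this
    exact this.symm
  rw [map_sub, map_add, map_sub, e0, e1, e2, e3] at hsum
  rw [← sub_eq_zero, ← hsum]
  abel

theorem hom_ext_bracket (hR : ManyUnits R) {A : Type*} [AddCommGroup A]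
    {f g : H0 R 1 (Cycles R) →+ A} (h : ∀ a b, f (bracket a b) = g (bracket a b)) : f = g := by
  have hle : DD R 2 ≤ AddSubgroup.map (DD R 2).subtype
      ((f.comp (boundaryClass R)).eqLocus (g.comp (boundaryClass R))) := by
    refine DD_le fun v hv => ?_
    obtain ⟨x, y, a, b, hxy, rfl⟩ := hv.exists_eq
    refine ⟨⟨_, single_mem_DD hv 1⟩, ?_, rfl⟩
    change f (boundaryClass R _) = g (boundaryClass R _)
    rw [boundaryClass_single hxy rfl, h]
  refine AddMonoidHom.ext fun q => ?_
  obtain ⟨d, rfl⟩ := boundaryClass_surjective hR q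
  obtain ⟨d', hd', hdd⟩ := hle d.2
  obtain rfl : d' = d := Subtype.ext hdd
  exact hd'

section Lift

variable {A : Type} [AddCommGroup A] (F : Rˣ → Rˣ → A)

open Classical in
/-- The homomorphism sending a frame `(v₀, v₁, a v₀ + b v₁)` to `F a b`. -/
noncomputable def frameHom : EE R 2 →+ A :=
  Finsupp.liftAddHom fun v => zmultiplesHom A
    (if h : ∃ p : Rˣ × Rˣ, v 2 = p.1 • v 0 + p.2 • v 1 then F h.choose.1 h.choose.2 else 0)

theorem frameHom_single {x y z : V2 R} {a b : Rˣ} (h : IsUnit (detPair x y))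
    (hz : z = a • x + b • y) : frameHom F (Finsupp.single ![x, y, z] 1) = F a b := by
  have hex : ∃ p : Rˣ × Rˣ, ![x, y, z] 2 = p.1 • ![x, y, z] 0 + p.2 • ![x, y, z] 1 :=
    ⟨(a, b), hz⟩
  have hu := units_unique h (hz.symm.trans hex.choose_spec)
  simp only [frameHom, Finsupp.liftAddHom_apply_single, zmultiplesHom_apply, one_smul]
  rw [dif_pos hex, ← hu.1, ← hu.2]

theorem frameHom_mapDomain (g : GL (Fin 2) R) {d : EE R 2} (hd : d ∈ DD R 2) :
    frameHom F (Finsupp.mapDomain (gT R g) d) = frameHom F d := by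
  suffices DD R 2 ≤ ((frameHom F).comp
      (Finsupp.mapDomain.addMonoidHom (gT R g))).eqLocus (frameHom F) from this hd
  refine DD_le fun v hv => ?_
  obtain ⟨x, y, a, b, hxy, rfl⟩ := hv.exists_eq
  change frameHom F (Finsupp.mapDomain _ _) = _
  rw [Finsupp.mapDomain_single, frameHom_single F hxy rfl,
    tup_two_eta (gT R g _)]
  refine frameHom_single F ?_ ?_
  · exact (isFrame_iff _).mp (hv.gT g) 0 1 (by decide)
  · simp only [gT, Units.smul_def, Matrix.mulVec_add, Matrix.mulVec_smul, Matrix.cons_val]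

variable {F}

theorem frameHom_bdE_two (hF : FrameRelation F) {x : EE R 3} (hx : x ∈ DD R 3) :
    frameHom F (bdE R 2 x) = 0 := by
  suffices DD R 3 ≤ ((frameHom F).comp (bdE R 2)).ker from this hx
  refine DD_le fun v hv => ?_
  have hdet := (isFrame_iff v).mp hv
  have h : IsUnit (detPair (v 0) (v 1)) := hdet 0 1 (by decide)
  obtain ⟨a₁, a₂, hz⟩ := exists_units_of_isFrame h (hdet 2 1 (by decide)) (hdet 0 2 (by decide))
  obtain ⟨b₁, b₂, hw⟩ := exists_units_of_isFrame h (hdet 3 1 (by decide)) (hdet 0 3 (by decide))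
  obtain ⟨s, rfl⟩ : ∃ s, b₁ = a₁ * s := ⟨a₁⁻¹ * b₁, by simp⟩
  obtain ⟨t, rfl⟩ : ∃ t, b₂ = a₂ * t := ⟨a₂⁻¹ * b₂, by simp⟩
  have hst : IsUnit ((s : R) - t) := by
    have h23 := hdet 2 3 (by decide)
    have : detPair (v 2) (v 3) = -((s : R) - t) * (a₁ * a₂ * detPair (v 0) (v 1)) := by
      rw [hz, hw]
      simp only [detPair, Pi.add_apply, Pi.smul_apply, Units.smul_def, smul_eq_mul,
        Units.val_mul]
      ring
    rw [this] at h23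
    exact (IsUnit.neg_iff _).mp (isUnit_of_mul_isUnit_left h23)
  obtain ⟨d, hd⟩ := hst
  have hw1 := hz ▸ hw.trans (smul_add_eq_left (v 0) (v 1) hd)
  have hw2 := hz ▸ hw.trans (smul_add_eq_right (v 0) (v 1) hd)
  rw [AddMonoidHom.mem_ker, AddMonoidHom.comp_apply, tup_three_eta v, bdE_two_single, map_sub,
    map_add, map_sub, frameHom_single F (hdet 1 2 (by decide)) hw1,
    frameHom_single F (hdet 0 2 (by decide)) hw2, frameHom_single F h hw,
    frameHom_single F h hz]
  have := hF a₁ a₂ s t d hd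
  grind

theorem exists_lift (hR : ManyUnits R) (hF : FrameRelation F) :
    ∃ f : H0 R 1 (Cycles R) →+ A, ∀ a b, f (bracket a b) = F a b := by
  have hindep : ∀ d ∈ DD R 2, ∀ d' ∈ DD R 2, bdE R 1 d = bdE R 1 d' →
      frameHom F d = frameHom F d' := by
    intro d hd d' hd' h
    obtain ⟨y, hy, hyd⟩ := hR.exists_bdE_eq (sub_mem hd hd') (by rw [map_sub, h, sub_self])
    rw [← sub_eq_zero, ← map_sub, ← hyd, frameHom_bdE_two hF hy]
  choose c hc hcb using fun p : Cycles R => hR.exists_bdE_eq p.2.1 p.2.2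
  let ψ : Cycles R →+ A := AddMonoidHom.mk' (fun p => frameHom F (c p)) fun p q => by
    rw [← map_add]
    exact hindep _ (hc _) _ (add_mem (hc _) (hc _)) (by rw [map_add, hcb, hcb, hcb]; rfl)
  have hψ : ∀ (p : Cycles R) (d : EE R 2), d ∈ DD R 2 → (p : EE R 1) = bdE R 1 d →
      ψ p = frameHom F d := fun p d hd h => hindep _ (hc p) _ hd ((hcb p).trans h)
  have hle : coinvOf R 1 (Cycles R) ≤ AddSubgroup.map (Cycles R).subtype ψ.ker := by
    refine (AddSubgroup.closure_le _).mpr ?_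
    rintro _ ⟨g, y, hy, rfl⟩
    obtain ⟨d, hd, rfl⟩ := hR.exists_bdE_eq hy.1 hy.2
    have hgd := mapDomain_gT_mem_DD g hd
    have hbd : Finsupp.mapDomain (gT R g) (bdE R 1 d) - bdE R 1 d =
        bdE R 1 (Finsupp.mapDomain (gT R g) d - d) := by
      rw [map_sub, bdE_mapDomain_gT]
    refine ⟨⟨_, bdE_mem_DD (sub_mem hgd hd), bdE_zero_bdE_one _⟩, ?_, hbd.symm⟩
    rw [SetLike.mem_coe, AddMonoidHom.mem_ker, hψ _ _ (sub_mem hgd hd) rfl, map_sub,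
      frameHom_mapDomain F g hd, sub_self]
  refine ⟨QuotientAddGroup.lift _ ψ fun p hp => ?_, fun a b => ?_⟩
  · obtain ⟨q, hq, hqp⟩ := hle (AddSubgroup.mem_addSubgroupOf.mp hp)
    obtain rfl : q = p := Subtype.ext hqp
    exact hq
  · exact (hψ _ _ (single_mem_DD (isFrame_std a b) 1) rfl).trans
      (frameHom_single F (isUnit_detPair_std R) (smul_add_eq a b).symm)

end Lift

end Coinvariants

section MilnorK

variable {R : Type} [CommRing R]

variable (R) in
theorem isSteinbergSymbol_clsK : IsSteinbergSymbol fun a b : Rˣ => clsK R (tmulU R a b) where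
  mul_left a b c := by
    rw [← map_add, tmulU, ofMul_mul, TensorProduct.add_tmul]
    rfl
  mul_right a b c := by
    rw [← map_add, tmulU, ofMul_mul, TensorProduct.tmul_add]
    rfl
  one_sub a b h :=
    (QuotientAddGroup.eq_zero_iff _).mpr (AddSubgroup.subset_closure ⟨a, b, h, rfl⟩)

theorem K2M_hom_ext {A : Type*} [AddCommGroup A] {f g : K2M R →+ A}
    (h : ∀ a b, f (clsK R (tmulU R a b)) = g (clsK R (tmulU R a b))) : f = g := by
  refine QuotientAddGroup.addMonoidHom_ext _ (AddMonoidHom.ext fun t => ?_)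
  induction t using TensorProduct.induction_on with
  | zero => simp
  | tmul a b => exact h a.toMul b.toMul
  | add x y hx hy => rw [map_add, map_add, hx, hy]

/-- The universal property of the Milnor K-group. -/
theorem IsSteinbergSymbol.exists_lift {A : Type} [AddCommGroup A] {L : Rˣ → Rˣ → A}
    (h : IsSteinbergSymbol L) :
    ∃ f : K2M R →+ A, ∀ a b, f (clsK R (tmulU R a b)) = L a b := by
  let β : Additive Rˣ →+ Additive Rˣ →+ A :=
    AddMonoidHom.mk' (fun a => AddMonoidHom.mk' (fun b => L a.toMul b.toMul)
      fun b c => h.mul_right _ _ _) fun a b => AddMonoidHom.ext fun c => h.mul_left _ _ _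
  let φ : TT R →+ A := TensorProduct.liftAddHom β fun n a b => by simp
  have hφ : ∀ a b, φ (tmulU R a b) = L a b := fun a b => rfl
  refine ⟨QuotientAddGroup.lift _ φ ?_, hφ⟩
  refine (AddSubgroup.closure_le _).mpr ?_
  rintro _ ⟨a, b, hab, rfl⟩
  exact (hφ a b).trans (h.one_sub a b hab)

end MilnorK

/-- For a ring with many units,
`S(R) := H₀(GL₂(R), ker(∂₁ : D₁(R²) → D₀(R²)))` is isomorphic to `ℤ ⊕ K₂^M(R)`;
under the identification of `S(R)` as generated by the classes `[a₁,a₂]`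
(the classes of the cycles `∂₂(e₁, e₂, a₁e₁+a₂e₂)`), the projection onto `K₂^M(R)`
is `[a,b] ↦ {a,b}`, and the splitting `ℤ → S(R)` is `n ↦ n·[1,1]`. -/
theorem stmt7 (R : Type) [CommRing R] (hR : ManyUnits R) :
    ∃ e : H0 R 1 (DD R 1 ⊓ (bdE R 0).ker) ≃+ ℤ × K2M R,
      (∀ (a b : Rˣ) (x : ↥(DD R 1 ⊓ (bdE R 0).ker)),
        (x : EE R 1)
            = bdE R 1 (Finsupp.single ![![1, 0], ![0, 1], ![(a : R), (b : R)]] 1) →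
        (e (QuotientAddGroup.mk x)).2 = clsK R (tmulU R a b)) ∧
      (∀ (x : ↥(DD R 1 ⊓ (bdE R 0).ker)) (n : ℤ),
        (x : EE R 1)
            = bdE R 1 (Finsupp.single ![![1, 0], ![0, 1], ![(1 : R), (1 : R)]] 1) →
        e.symm (n, 0) = n • (QuotientAddGroup.mk x :
          H0 R 1 (DD R 1 ⊓ (bdE R 0).ker))) := by
  obtain ⟨f, hf⟩ := exists_lift hR
    (F := fun a b => ((1, clsK R (tmulU R a b)) : ℤ × K2M R)) fun a₁ a₂ s t d hd => by
      simpa using (isSteinbergSymbol_clsK R).frameRelation hR a₁ a₂ s t d hd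
  obtain ⟨k, hk⟩ := ((frameRelation_bracket R).isSteinbergSymbol hR).exists_lift
  let g : ℤ × K2M R →+ H0 R 1 (Cycles R) :=
    (zmultiplesHom (H0 R 1 (Cycles R)) (bracket 1 1)).coprod k
  have hgf : g.comp f = AddMonoidHom.id _ := hom_ext_bracket hR fun a b => by
    simp [g, hf, hk]
  have hone : f (bracket 1 1) = (1, 0) := by
    rw [hf, (isSteinbergSymbol_clsK R).one_left]
  have hfk : f.comp k = AddMonoidHom.inr ℤ (K2M R) := K2M_hom_ext fun a b => by
    rw [AddMonoidHom.comp_apply, hk, map_sub, hone, hf]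
    simp
  have hfg : f.comp g = AddMonoidHom.id _ := by
    refine AddMonoidHom.ext fun ⟨n, q⟩ => ?_
    have := DFunLike.congr_fun hfk q
    rw [AddMonoidHom.comp_apply] at this
    simp [g, hone, this]
  refine ⟨f.toAddEquiv g hgf hfg, fun a b x hx => ?_, fun x n hx => ?_⟩
  · rw [← boundaryClass_apply ⟨_, single_mem_DD (isFrame_std a b) 1⟩ x hx]
    exact congrArg Prod.snd (hf a b)
  · rw [← boundaryClass_apply ⟨_, single_mem_DD (isFrame_std 1 1) 1⟩ x hx]
    change g (n, 0) = n • bracket 1 1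
    simp [g]
end

section
/- Let R be a commutative ring. For all units a, b ∈ R^×, the element a ⊗ b + b ⊗ a of R^× ⊗_ℤ R^× lies in the subgroup generated by the elements c ⊗ (−c), c ∈ R^×; explicitly, a ⊗ b + b ⊗ a = (ab) ⊗ (−ab) − a ⊗ (−a) − b ⊗ (−b) in R^× ⊗_ℤ R^×. Consequently the map η : p(R) → (R^× ⊗ R^×)_σ̄, [a] ↦ a ⊗ (1−a), is a well-defined homomorphism. -/
/-- The index set for the generators `[a]` of the pre-Bloch group: elements `a` of `R`
with `a` and `1 - a` units. -/
abbrev Wt (R : Type) [CommRing R] : Type := {a : R // IsUnit a ∧ IsUnit (1 - a)}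

/-- The subgroup of relations of the pre-Bloch group: it is generated by the elements
`[a] - [b] + [b/a] - [(1-a⁻¹)/(1-b⁻¹)] + [(1-a)/(1-b)]` for `a, 1-a, b, 1-b, a-b` units. -/
noncomputable def pbRel (R : Type) [CommRing R] : AddSubgroup (Wt R →₀ ℤ) :=
  AddSubgroup.closure
    {x | ∃ a b c d e : Wt R, IsUnit ((a : R) - (b : R)) ∧
      (c : R) = (b : R) * Ring.inverse (a : R) ∧
      (d : R) = (1 - Ring.inverse (a : R)) * Ring.inverse (1 - Ring.inverse (b : R)) ∧
      (e : R) = (1 - (a : R)) * Ring.inverse (1 - (b : R)) ∧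
      x = Finsupp.single a 1 - Finsupp.single b 1 + Finsupp.single c 1
          - Finsupp.single d 1 + Finsupp.single e 1}

/-- The pre-Bloch group `𝔭(R)`. -/
abbrev pBloch (R : Type) [CommRing R] : Type := (Wt R →₀ ℤ) ⧸ pbRel R

/-- The generator `[a]` of the pre-Bloch group. -/
noncomputable def pcl (R : Type) [CommRing R] (a : Wt R) : pBloch R :=
  QuotientAddGroup.mk (Finsupp.single a 1)

theorem tmulU_mul_left (R : Type) [CommRing R] (a b c : Rˣ) :
    tmulU R (a * b) c = tmulU R a c + tmulU R b c := by
  simp only [tmulU, ofMul_mul, TensorProduct.add_tmul]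

theorem tmulU_mul_right (R : Type) [CommRing R] (a b c : Rˣ) :
    tmulU R a (b * c) = tmulU R a b + tmulU R a c := by
  simp only [tmulU, ofMul_mul, TensorProduct.tmul_add]

theorem tmulU_inv_left (R : Type) [CommRing R] (a c : Rˣ) :
    tmulU R a⁻¹ c = -tmulU R a c := by
  simp only [tmulU, ofMul_inv, TensorProduct.neg_tmul]

theorem tmulU_inv_right (R : Type) [CommRing R] (a c : Rˣ) :
    tmulU R a c⁻¹ = -tmulU R a c := by
  simp only [tmulU, ofMul_inv, TensorProduct.tmul_neg]

theorem tmulU_add_swap_eq (R : Type) [CommRing R] (a b : Rˣ) :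
    tmulU R a b + tmulU R b a
      = tmulU R (a * b) (-(a * b)) - tmulU R a (-a) - tmulU R b (-b) := by
  have h₁ : -(a * b) = -a * b := (neg_mul a b).symm
  have h₂ : -(a * b) = -b * a := by rw [neg_mul, mul_comm]
  rw [tmulU_mul_left]
  nth_rewrite 1 [h₁]
  rw [h₂, tmulU_mul_right, tmulU_mul_right]
  abel

theorem tmulU_add_swap_mem (R : Type) [CommRing R] (a b : Rˣ) :
    tmulU R a b + tmulU R b a ∈ sbarSub R := by
  have h (c : Rˣ) : tmulU R c (-c) ∈ sbarSub R := AddSubgroup.subset_closure ⟨c, rfl⟩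
  rw [tmulU_add_swap_eq]
  exact sub_mem (sub_mem (h _) (h _)) (h _)

/-- The element `a ⊗ (1 - a)` of `R^× ⊗ R^×`. -/
noncomputable def tmulOneSub (R : Type) [CommRing R] (a : Wt R) : TT R :=
  tmulU R a.2.1.unit a.2.2.unit

/-- The five-term relation is sent by `[a] ↦ a ⊗ (1 - a)` to a combination of
symmetrized tensors. -/
theorem tmulOneSub_five_term (R : Type) [CommRing R] (a b c d e : Wt R)
    (hab : IsUnit ((a : R) - (b : R)))
    (hc : (c : R) = (b : R) * Ring.inverse (a : R))
    (hd : (d : R) = (1 - Ring.inverse (a : R)) * Ring.inverse (1 - Ring.inverse (b : R)))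
    (he : (e : R) = (1 - (a : R)) * Ring.inverse (1 - (b : R))) :
    tmulOneSub R a - tmulOneSub R b + tmulOneSub R c - tmulOneSub R d + tmulOneSub R e
      = (tmulU R a.2.1.unit a.2.2.unit + tmulU R a.2.2.unit a.2.1.unit)
        - (tmulU R b.2.2.unit a.2.1.unit + tmulU R a.2.1.unit b.2.2.unit) := by
  obtain ⟨D, hD⟩ := hab
  obtain ⟨_, ⟨A, rfl⟩, A', hA'⟩ := a
  obtain ⟨_, ⟨B, rfl⟩, B', hB'⟩ := b
  obtain ⟨_, ⟨C, rfl⟩, C', hC'⟩ := c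
  obtain ⟨_, ⟨F, rfl⟩, F', hF'⟩ := d
  obtain ⟨_, ⟨E, rfl⟩, E', hE'⟩ := e
  have inv_one_sub : Ring.inverse (1 - (↑B⁻¹ : R)) = ↑(-(B * B'⁻¹)) := by
    have : (1 - (↑B⁻¹ : R)) = ↑(-(B' * B⁻¹)) := by
      push_cast
      rw [hB', sub_mul, Units.mul_inv]
      ring
    rw [this, Ring.inverse_unit, inv_neg, mul_inv_rev, inv_inv]
  simp only [Ring.inverse_unit, ← hB', ← hA', inv_one_sub] at hD hc hd he
  have hA : (A : R) * ↑A⁻¹ = 1 := A.mul_inv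
  have hB : (B' : R) * ↑B'⁻¹ = 1 := B'.mul_inv
  have hCeq : C = B * A⁻¹ := Units.ext (by simpa using hc)
  have hEeq : E = A' * B'⁻¹ := Units.ext (by simpa using he)
  have hFeq : F = A' * A⁻¹ * B * B'⁻¹ := Units.ext (by
    rw [hd]
    push_cast
    rw [hA']
    linear_combination ((B : R) * ↑B'⁻¹) * hA)
  have hCeq' : C' = D * A⁻¹ := Units.ext (by
    rw [hC', hCeq]
    push_cast
    rw [hD]
    linear_combination -hA)
  have hEeq' : E' = D * B'⁻¹ := Units.ext (by
    rw [hE', hEeq]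
    push_cast
    rw [hD]
    linear_combination -hB - (↑B'⁻¹ : R) * hA' + (↑B'⁻¹ : R) * hB')
  have hFeq' : F' = D * A⁻¹ * B'⁻¹ := Units.ext (by
    rw [hF', hFeq]
    push_cast
    rw [hD]
    linear_combination -hB + (↑B'⁻¹ : R) * (B - 1) * hA + (↑B'⁻¹ : R) * hB'
      - (↑A⁻¹ : R) * B * ↑B'⁻¹ * hA')
  have unit_eq (v : Rˣ) (x : R) (h : IsUnit x) (hv : (v : R) = x) : h.unit = v :=
    Units.ext hv.symm
  simp only [tmulOneSub, unit_eq A _ _ rfl, unit_eq B _ _ rfl, unit_eq C _ _ rfl,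
    unit_eq E _ _ rfl, unit_eq F _ _ rfl, unit_eq A' _ _ hA', unit_eq B' _ _ hB',
    unit_eq C' _ _ hC', unit_eq E' _ _ hE', unit_eq F' _ _ hF']
  rw [hCeq', hEeq', hFeq', hCeq, hEeq, hFeq]
  simp only [tmulU_mul_left, tmulU_mul_right, tmulU_inv_left, tmulU_inv_right]
  abel

/-- `a ⊗ b + b ⊗ a` lies in the subgroup generated by the `c ⊗ (-c)`;
explicitly `a ⊗ b + b ⊗ a = (ab) ⊗ (-ab) - a ⊗ (-a) - b ⊗ (-b)`.  Consequently the map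
`η : 𝔭(R) → (R^× ⊗ R^×)_σ̄`, `[a] ↦ a ⊗ (1-a)`, is a well-defined homomorphism. -/
theorem stmt13 (R : Type) [CommRing R] :
    (∀ a b : Rˣ, tmulU R a b + tmulU R b a ∈ sbarSub R) ∧
    (∀ a b : Rˣ, tmulU R a b + tmulU R b a
        = tmulU R (a * b) (-(a * b)) - tmulU R a (-a) - tmulU R b (-b)) ∧
    ∃ eta : pBloch R →+ Tsigmabar R,
      ∀ a : Wt R, eta (pcl R a) = clsSb R (tmulU R a.2.1.unit a.2.2.unit) := by
  refine ⟨tmulU_add_swap_mem R, tmulU_add_swap_eq R, ?_⟩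
  let f : (Wt R →₀ ℤ) →+ Tsigmabar R :=
    Finsupp.liftAddHom fun a => zmultiplesHom _ (clsSb R (tmulOneSub R a))
  have hf (a : Wt R) : f (Finsupp.single a 1) = clsSb R (tmulOneSub R a) := by
    simp [f]
  have hle : pbRel R ≤ f.ker := by
    refine (AddSubgroup.closure_le _).2 ?_
    rintro _ ⟨a, b, c, d, e, hab, hc, hd, he, rfl⟩
    simp only [SetLike.mem_coe, AddMonoidHom.mem_ker, map_add, map_sub, hf]
    simp only [← map_add, ← map_sub]
    rw [tmulOneSub_five_term R a b c d e hab hc hd he]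
    exact (QuotientAddGroup.eq_zero_iff _).2
      (sub_mem (tmulU_add_swap_mem R _ _) (tmulU_add_swap_mem R _ _))
  exact ⟨QuotientAddGroup.lift _ f hle, hf⟩
end

section
/- Let R be a commutative ring with many units and let α : (R^× ⊗ R^×)_σ → (R^× ⊗ R^×)_σ̄ be the canonical map. Then ker(α) is generated by the classes of the elements a ⊗ (−a) with a, 1−a ∈ R^×. -/
theorem clsS_tmulU_add_swap (R : Type) [CommRing R] (a b : Rˣ) :
    clsS R (tmulU R a b) + clsS R (tmulU R b a) = 0 := by
  rw [← map_add]
  exact (QuotientAddGroup.eq_zero_iff _).2 (AddSubgroup.subset_closure ⟨a, b, rfl⟩)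

/-- The map `a ↦ a ⊗ (-a)` is multiplicative modulo `a ⊗ b + b ⊗ a`. -/
theorem clsS_tmulU_neg_mul (R : Type) [CommRing R] (a b : Rˣ) :
    clsS R (tmulU R (a * b) (-(a * b))) =
      clsS R (tmulU R a (-a)) + clsS R (tmulU R b (-b)) := by
  have h := clsS_tmulU_add_swap R a b
  have hneg : ∀ c : Rˣ, -c = -1 * c := fun c => by simp
  rw [hneg (a * b), hneg a, hneg b]
  simp only [tmulU_mul_left, tmulU_mul_right, map_add]
  rw [← sub_eq_zero, ← h]
  abel

/-- In a ring with many units, every unit is a product of two units `u` with `1 - u` a unit. -/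
theorem ManyUnits.exists_mul_eq {R : Type} [CommRing R] (hR : ManyUnits R) (a : Rˣ) :
    ∃ u v : Rˣ, IsUnit ((1 : R) - u) ∧ IsUnit ((1 : R) - v) ∧ a = u * v := by
  let x : (Fin 2 → R) →ₗ[R] R := LinearMap.proj 0
  let y : (Fin 2 → R) →ₗ[R] R := LinearMap.proj 1
  obtain ⟨w, hw⟩ := hR 2 le_rfl 4 ![x, y, y - x, x - (a : R) • y] (by
    intro i
    fin_cases i
    · exact fun r => ⟨![r, 0], by simp [x]⟩
    · exact fun r => ⟨![0, r], by simp [y]⟩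
    · exact fun r => ⟨![0, r], by simp [x, y]⟩
    · exact fun r => ⟨![r, 0], by simp [x, y]⟩)
  obtain ⟨p, hp⟩ : IsUnit (w 0) := by simpa [x] using hw 0
  obtain ⟨q, hq⟩ : IsUnit (w 1) := by simpa [y] using hw 1
  have h₂ : IsUnit ((q : R) - p) := by simpa [x, y, hp, hq] using hw 2
  have h₃ : IsUnit ((p : R) - a * q) := by simpa [x, y, hp, hq] using hw 3
  refine ⟨p * q⁻¹, a * q * p⁻¹, ?_, ?_, by rw [mul_comm]; group⟩
  · have : (1 : R) - ((p * q⁻¹ : Rˣ) : R) = (q - p) * (q⁻¹ : Rˣ) := by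
      simp [sub_mul]
    rw [this]
    exact h₂.mul (Units.isUnit _)
  · have : (1 : R) - ((a * q * p⁻¹ : Rˣ) : R) = (p - a * q) * (p⁻¹ : Rˣ) := by
      simp [sub_mul]
    rw [this]
    exact h₃.mul (Units.isUnit _)

/-- For a ring with many units, the kernel of the canonical map
`α : (R^× ⊗ R^×)_σ → (R^× ⊗ R^×)_σ̄` is generated by the classes of the elements
`a ⊗ (-a)` with `a`, `1-a` units. -/
theorem stmt16 (R : Type) [CommRing R] (hR : ManyUnits R)
    (alpha : Tsigma R →+ Tsigmabar R)
    (halpha : ∀ x : TT R, alpha (clsS R x) = clsSb R x) :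
    alpha.ker = AddSubgroup.closure
      {y : Tsigma R | ∃ a : Rˣ, IsUnit ((1 : R) - (a : R)) ∧ y = clsS R (tmulU R a (-a))} := by
  apply le_antisymm
  · intro y hy
    obtain ⟨t, rfl⟩ := QuotientAddGroup.mk'_surjective _ y
    change alpha (clsS R t) = 0 at hy
    rw [halpha] at hy
    have ht : t ∈ sbarSub R := (QuotientAddGroup.eq_zero_iff t).1 hy
    refine (AddSubgroup.closure_le (AddSubgroup.comap (clsS R) (AddSubgroup.closure
      {y : Tsigma R | ∃ a : Rˣ, IsUnit ((1 : R) - (a : R)) ∧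
        y = clsS R (tmulU R a (-a))}))).2 ?_ ht
    rintro _ ⟨a, rfl⟩
    obtain ⟨u, v, hu, hv, rfl⟩ := hR.exists_mul_eq a
    rw [SetLike.mem_coe, AddSubgroup.mem_comap]
    rw [clsS_tmulU_neg_mul]
    exact add_mem (AddSubgroup.subset_closure ⟨u, hu, rfl⟩)
      (AddSubgroup.subset_closure ⟨v, hv, rfl⟩)
  · refine (AddSubgroup.closure_le _).2 ?_
    rintro _ ⟨a, -, rfl⟩
    change alpha _ = 0
    rw [halpha]
    exact (QuotientAddGroup.eq_zero_iff _).2 (AddSubgroup.subset_closure ⟨a, rfl⟩)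
end
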